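/- arXiv:1309.3251 — 3 statements merged into one kernel-verified Lean document; each statement's English description precedes it below -/
import Mathlib

section
/- Let n ≥ 1, let S ⊆ ℤⁿ be a finite set, and fix i ∈ {1,…,n}. Let Sᵢ be the i-th central compression of S, and let eᵢ denote the i-th standard basis vector of ℤⁿ. Then gap_{eᵢ}(Sᵢ) = ∅ and gap_{-eᵢ}(Sᵢ) = ∅. -/
/-- `gap_ε(T) = {x ∈ ℤⁿ : x - ε ∈ T, x ∉ T, x + bε ∈ T for some b ≥ 1}`. -/
def gapSet (n : ℕ) (T : Set (Fin n → ℤ)) (ε : Fin n → ℤ) : Set (Fin n → ℤ) :=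
  {x | x - ε ∈ T ∧ x ∉ T ∧ ∃ b : ℤ, 1 ≤ b ∧ x + b • ε ∈ T}

/-- The centered interval of size `m`: `{x : -⌊(m-1)/2⌋ ≤ x ≤ ⌈(m-1)/2⌉}`
(empty for `m = 0`); note `⌈(m-1)/2⌉ = ⌊m/2⌋` for `m ≥ 1`. -/
def centralInterval (m : ℕ) : Set ℤ :=
  if m = 0 then ∅ else Set.Icc (-(((m - 1) / 2 : ℕ) : ℤ)) ((m / 2 : ℕ) : ℤ)

/-- The `i`-th central compression of `S`: each nonempty 1-dimensional
`i`-section of `S` is replaced by the centered interval of the same size. -/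
noncomputable def centralCompression (n : ℕ) (i : Fin n) (S : Set (Fin n → ℤ)) :
    Set (Fin n → ℤ) :=
  {u | u i ∈ centralInterval (Set.ncard {x : ℤ | Function.update u i x ∈ S})}

theorem ordConnected_centralInterval (m : ℕ) : (centralInterval m).OrdConnected := by
  unfold centralInterval
  split_ifs
  · exact Set.ordConnected_empty
  · exact Set.ordConnected_Icc

theorem add_zsmul_single_mem_centralCompression_iff (n : ℕ) (i : Fin n) (S : Set (Fin n → ℤ))
    (u : Fin n → ℤ) (c : ℤ) :
    u + c • Pi.single i 1 ∈ centralCompression n i S ↔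
      u i + c ∈ centralInterval (Set.ncard {x : ℤ | Function.update u i x ∈ S}) := by
  have hu (x : ℤ) : Function.update (u + c • Pi.single i 1) i x = Function.update u i x := by
    ext j
    by_cases hj : j = i
    · subst hj
      simp
    · simp [hj]
  simp only [centralCompression, Set.mem_ofPred_eq, hu]
  simp

/-- Central compression along `i` leaves no gaps in any direction parallel to the `i`-th axis. -/
theorem gapSet_centralCompression_zsmul_single (n : ℕ) (i : Fin n) (S : Set (Fin n → ℤ)) (a : ℤ) :
    gapSet n (centralCompression n i S) (a • Pi.single i 1) = ∅ := by
  rw [Set.eq_empty_iff_forall_notMem]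
  rintro u ⟨h₁, h₂, b, hb, h₃⟩
  rw [sub_eq_add_neg, ← neg_smul, add_zsmul_single_mem_centralCompression_iff] at h₁
  rw [smul_smul, add_zsmul_single_mem_centralCompression_iff] at h₃
  refine h₂ ?_
  have h₀ := add_zsmul_single_mem_centralCompression_iff n i S u 0
  rw [zero_smul, add_zero, add_zero] at h₀
  rw [h₀]
  have hI := ordConnected_centralInterval (Set.ncard {x : ℤ | Function.update u i x ∈ S})
  rcases le_total 0 a with ha | ha
  · exact hI.out h₁ h₃ ⟨by linarith, by nlinarith⟩
  · exact hI.out h₃ h₁ ⟨by nlinarith, by linarith⟩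

theorem gap_centralCompression_eq_empty
    (n : ℕ) (hn : 1 ≤ n) (S : Set (Fin n → ℤ)) (hS : S.Finite) (i : Fin n) :
    gapSet n (centralCompression n i S) (Pi.single i 1) = ∅ ∧
      gapSet n (centralCompression n i S) (-Pi.single i 1) = ∅ := by
  constructor
  · simpa only [one_smul] using gapSet_centralCompression_zsmul_single n i S 1
  · simpa only [neg_smul, one_smul] using gapSet_centralCompression_zsmul_single n i S (-1)
end

section
/- Let n ≥ 1, let S ⊆ ℤⁿ be a finite set, and fix i ∈ {1,…,n}. Then there exists a finite set S' ⊆ ℤⁿ with |S'| = |S|, |∂_e(S')| ≤ |∂_e(S)|, gap_{eᵢ}(S') = ∅, and gap_{-eᵢ}(S') = ∅, where eᵢ is the i-th standard basis vector of ℤⁿ. -/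
/-- The number of edges in the edge boundary of `S` in the graph `Gₙ`
(vertices `ℤⁿ`, edges between points at `ℓ∞`-distance 1), counted as the
number of ordered pairs `(u, v)` with `u ∈ S`, `v ∉ S`, `‖u - v‖_∞ = 1`. -/
noncomputable def edgeBoundaryCard (n : ℕ) (S : Set (Fin n → ℤ)) : ℕ :=
  Set.ncard {p : (Fin n → ℤ) × (Fin n → ℤ) |
    p.1 ∈ S ∧ p.2 ∉ S ∧ p.1 ≠ p.2 ∧ ∀ i, |p.1 i - p.2 i| ≤ 1}

section

open Finset
open scoped Pointwise

/-- The interval of `k` integers centred at `0` or `-1/2`. -/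
noncomputable def centeredInterval (k : ℕ) : Finset ℤ := Ico (-((k : ℤ) / 2)) (k - (k : ℤ) / 2)

theorem mem_centeredInterval {k : ℕ} {x : ℤ} :
    x ∈ centeredInterval k ↔ -((k : ℤ) / 2) ≤ x ∧ x < k - (k : ℤ) / 2 := by
  simp [centeredInterval]

@[simp] theorem card_centeredInterval (k : ℕ) : #(centeredInterval k) = k := by
  simp [centeredInterval]

theorem centeredInterval_mono {k m : ℕ} (h : k ≤ m) :
    centeredInterval k ⊆ centeredInterval m := by
  intro x
  simp only [mem_centeredInterval]
  omega

/-- The pairs `(a, b)` with `a ∈ A`, `b ∈ B` and `|a - b| ≤ 1`. -/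
def closePairs (A B : Finset ℤ) : Finset (ℤ × ℤ) := {p ∈ A ×ˢ B | |p.1 - p.2| ≤ 1}

/-- The pairs `(a, b)` with `a ∈ A`, `b ∉ B` and `|a - b| ≤ 1`. -/
noncomputable def exitPairs (A B : Finset ℤ) : Finset (ℤ × ℤ) :=
  {p ∈ A ×ˢ (A + Icc (-1) 1) | p.2 ∉ B ∧ |p.1 - p.2| ≤ 1}

theorem mem_add_Icc_of_abs_sub_le {A : Finset ℤ} {a b : ℤ} (ha : a ∈ A) (h : |a - b| ≤ 1) :
    b ∈ A + Icc (-1) 1 := by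
  rw [abs_le] at h
  exact mem_add.2 ⟨a, ha, b - a, by rw [mem_Icc]; omega, by ring⟩

theorem mem_exitPairs {A B : Finset ℤ} {p : ℤ × ℤ} :
    p ∈ exitPairs A B ↔ p.1 ∈ A ∧ p.2 ∉ B ∧ |p.1 - p.2| ≤ 1 := by
  simp only [exitPairs, mem_filter, mem_product]
  exact ⟨fun h => ⟨h.1.1, h.2⟩, fun h => ⟨⟨h.1, mem_add_Icc_of_abs_sub_le h.1 h.2.2⟩, h.2⟩⟩

theorem card_closePairs_comm (A B : Finset ℤ) : #(closePairs A B) = #(closePairs B A) := by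
  refine card_bij (fun p _ => p.swap) ?_ (fun _ _ _ _ h => Prod.swap_injective h) ?_
  · rintro ⟨a, b⟩ h
    simp_all [closePairs, abs_sub_comm]
  · rintro ⟨a, b⟩ h
    exact ⟨(b, a), by simp_all [closePairs, abs_sub_comm], rfl⟩

theorem card_exitPairs_add_card_closePairs (A B : Finset ℤ) :
    #(exitPairs A B) + #(closePairs A B) = 3 * #A := by
  have hd : Disjoint (exitPairs A B) (closePairs A B) := by
    rw [Finset.disjoint_left]
    intro p hp hq
    simp only [closePairs, mem_filter, mem_product] at hq
    exact (mem_exitPairs.1 hp).2.1 hq.1.2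
  rw [← card_union_of_disjoint hd, mul_comm]
  have : #(A ×ˢ Icc (-1 : ℤ) 1) = #A * 3 := by simp [card_product]
  rw [← this]
  symm
  refine card_bij (fun p _ => (p.1, p.1 + p.2)) ?_ ?_ ?_
  · rintro ⟨a, d⟩ h
    simp only [mem_product, mem_Icc] at h
    simp only [mem_union, mem_exitPairs, closePairs, mem_filter, mem_product, abs_le]
    by_cases hb : a + d ∈ B
    · exact Or.inr ⟨⟨h.1, hb⟩, by omega⟩
    · exact Or.inl ⟨h.1, hb, by omega⟩
  · rintro ⟨a, d⟩ _ ⟨a', d'⟩ _ h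
    simp only [Prod.mk.injEq] at h ⊢
    omega
  · rintro ⟨a, b⟩ h
    simp only [mem_union, mem_exitPairs, closePairs, mem_filter, mem_product, abs_le] at h
    refine ⟨(a, b - a), ?_, by simp⟩
    simp only [mem_product, mem_Icc]
    rcases h with h | h
    · exact ⟨h.1, by omega⟩
    · exact ⟨h.1.1, by omega⟩

theorem card_add_two_le_card_exitPairs_add_card {A : Finset ℤ} (hA : A.Nonempty) (B : Finset ℤ) :
    #A + 2 ≤ #(exitPairs A B) + #B := by
  have h : #A + #(Icc (-1 : ℤ) 1) - 1 ≤ #(A + Icc (-1 : ℤ) 1) :=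
    cauchy_davenport_add_of_linearOrder_isCancelAdd hA (by simp)
  have hsub : A + Icc (-1 : ℤ) 1 ⊆ (exitPairs A B).image Prod.snd ∪ B := by
    intro x hx
    obtain ⟨a, ha, d, hd, rfl⟩ := mem_add.1 hx
    rw [mem_Icc] at hd
    by_cases hb : a + d ∈ B
    · exact mem_union_right _ hb
    · refine mem_union_left _ (mem_image.2 ⟨(a, a + d), mem_exitPairs.2 ⟨ha, hb, ?_⟩, rfl⟩)
      rw [abs_le]
      dsimp only
      omega
  have h1 := card_le_card hsub
  have h2 := card_union_le ((exitPairs A B).image Prod.snd) B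
  have h3 : #((exitPairs A B).image Prod.snd) ≤ #(exitPairs A B) := card_image_le
  have h4 : #(Icc (-1 : ℤ) 1) = 3 := by simp
  omega

theorem card_exitPairs_centeredInterval_le {k m : ℕ} (h : k ≤ m) :
    #(exitPairs (centeredInterval k) (centeredInterval m)) ≤ k + 2 - m := by
  have h1 : #(exitPairs (centeredInterval k) (centeredInterval m)) ≤
      #(centeredInterval (k + 2) \ centeredInterval m) := by
    refine card_le_card_of_injOn Prod.snd ?_ ?_
    · rintro ⟨a, b⟩ hp
      have hp := mem_exitPairs.1 (mem_coe.1 hp)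
      simp only [mem_centeredInterval, abs_le] at hp
      simp only [mem_coe, mem_sdiff, mem_centeredInterval]
      omega
    · rintro ⟨a, b⟩ hp ⟨a', b'⟩ hp' (rfl : b = b')
      have hp := mem_exitPairs.1 (mem_coe.1 hp)
      have hp' := mem_exitPairs.1 (mem_coe.1 hp')
      simp only [mem_centeredInterval, abs_le] at hp hp'
      simp only [Prod.mk.injEq, and_true]
      omega
  refine h1.trans ?_
  rcases le_total m (k + 2) with hm | hm
  · rw [card_sdiff_of_subset (centeredInterval_mono hm)]
    simp
  · rw [sdiff_eq_empty_iff_subset.2 (centeredInterval_mono hm)]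
    simp

theorem card_exitPairs_centeredInterval_card_le (A B : Finset ℤ) :
    #(exitPairs (centeredInterval #A) (centeredInterval #B)) ≤ #(exitPairs A B) := by
  have e1 := card_exitPairs_add_card_closePairs A B
  have e2 := card_exitPairs_add_card_closePairs B A
  have e3 := card_exitPairs_add_card_closePairs (centeredInterval #A) (centeredInterval #B)
  have e4 := card_exitPairs_add_card_closePairs (centeredInterval #B) (centeredInterval #A)
  have c1 := card_closePairs_comm A B
  have c2 := card_closePairs_comm (centeredInterval #A) (centeredInterval #B)
  rw [card_centeredInterval] at e3 e4
  rcases A.eq_empty_or_nonempty with hA | hA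
  · have : #A = 0 := by simp [hA]
    omega
  rcases B.eq_empty_or_nonempty with hB | hB
  · have : #(closePairs A B) = 0 := by simp [hB, closePairs]
    omega
  have l1 := card_add_two_le_card_exitPairs_add_card hA B
  have l2 := card_add_two_le_card_exitPairs_add_card hB A
  rcases le_total #A #B with h | h
  · have := card_exitPairs_centeredInterval_le h
    omega
  · have := card_exitPairs_centeredInterval_le h
    omega

theorem Set.ncard_le_ncard_of_fiberwise {α β : Type*} (f : α → β) {X Y : Set α}
    (hX : X.Finite) (hY : Y.Finite)
    (h : ∀ b, (X ∩ f ⁻¹' {b}).ncard ≤ (Y ∩ f ⁻¹' {b}).ncard) : X.ncard ≤ Y.ncard := by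
  classical
  lift X to Finset α using hX
  lift Y to Finset α using hY
  rw [Set.ncard_coe_finset, Set.ncard_coe_finset,
    card_eq_sum_card_fiberwise (f := f) (t := (X ∪ Y).image f)
      (fun x hx => mem_coe.2 (Finset.mem_image_of_mem f (Finset.mem_union_left _ hx))),
    card_eq_sum_card_fiberwise (f := f) (t := (X ∪ Y).image f)
      (fun x hx => mem_coe.2 (Finset.mem_image_of_mem f (Finset.mem_union_right _ hx)))]
  refine sum_le_sum fun b _ => ?_
  have := h b
  rw [← Set.ncard_coe_finset, ← Set.ncard_coe_finset]
  convert this using 2 <;> ext <;> simp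

/-- The trace of `S` on the line through `y` in direction `i`. -/
def lineFiber {n : ℕ} (i : Fin n) (S : Set (Fin n → ℤ)) (y : Fin n → ℤ) : Set ℤ :=
  {t | Function.update y i t ∈ S}

/-- Replace every trace of `S` on a line in direction `i` by a centred interval of the same
cardinality. -/
noncomputable def lineCompression {n : ℕ} (i : Fin n) (S : Set (Fin n → ℤ)) :
    Set (Fin n → ℤ) :=
  {x | x i ∈ centeredInterval (lineFiber i S x).ncard}

section LineFiber

variable {n : ℕ} {i : Fin n} {S : Set (Fin n → ℤ)}

theorem lineFiber_finite (hS : S.Finite) (y : Fin n → ℤ) : (lineFiber i S y).Finite :=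
  hS.preimage (Function.update_injective y i).injOn

theorem lineFiber_update (y : Fin n → ℤ) (t : ℤ) :
    lineFiber i S (Function.update y i t) = lineFiber i S y := by
  simp [lineFiber]

theorem lineFiber_lineCompression (y : Fin n → ℤ) :
    lineFiber i (lineCompression i S) y = centeredInterval (lineFiber i S y).ncard := by
  ext t
  change Function.update y i t i ∈
    centeredInterval (lineFiber i S (Function.update y i t)).ncard ↔ _
  rw [lineFiber_update, Function.update_self, mem_coe]

theorem mem_lineFiber_self {x y : Fin n → ℤ} (h : Function.update x i 0 = y) :
    x i ∈ lineFiber i S y ↔ x ∈ S := by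
  subst h
  simp [lineFiber]

theorem lineCompression_finite (hS : S.Finite) : (lineCompression i S).Finite := by
  refine ((hS.image fun x => Function.update x i 0).biUnion fun y _ =>
    ((centeredInterval (lineFiber i S y).ncard).finite_toSet.image
      (Function.update y i))).subset ?_
  intro x hx
  have hx' : x i ∈ centeredInterval (lineFiber i S x).ncard := hx
  obtain ⟨t, ht⟩ : (lineFiber i S x).Nonempty := by
    apply Set.nonempty_of_ncard_ne_zero
    intro h0
    rw [h0] at hx'
    simp [centeredInterval] at hx'
  simp only [Set.mem_iUnion, Set.mem_image, exists_prop]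
  refine ⟨_, ⟨_, ht, rfl⟩, x i, ?_, by simp⟩
  rwa [lineFiber_update, lineFiber_update]

theorem ncard_inter_line (y : Fin n → ℤ) (hy : y i = 0) :
    (S ∩ (fun x => Function.update x i 0) ⁻¹' {y}).ncard = (lineFiber i S y).ncard := by
  refine Set.ncard_congr (fun x _ => x i) ?_ ?_ ?_
  · rintro x ⟨hx, hxy⟩
    exact (mem_lineFiber_self hxy).2 hx
  · rintro x x' ⟨_, hx⟩ ⟨_, hx'⟩ h
    have hx : Function.update x i 0 = y := hx
    have hx' : Function.update x' i 0 = y := hx'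
    rw [← Function.update_eq_self i x, ← Function.update_eq_self i x', h,
      ← Function.update_idem (a := i) 0 (x' i) x, ← Function.update_idem (a := i) 0 (x' i) x',
      hx, hx']
  · intro t ht
    refine ⟨Function.update y i t, ⟨ht, ?_⟩, by simp⟩
    simp [← hy]

theorem inter_line_eq_empty (y : Fin n → ℤ) (hy : y i ≠ 0) :
    S ∩ (fun x => Function.update x i 0) ⁻¹' {y} = ∅ := by
  rw [Set.eq_empty_iff_forall_notMem]
  rintro x ⟨_, rfl⟩
  simp at hy

theorem ncard_inter_line_lineCompression (y : Fin n → ℤ) :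
    (lineCompression i S ∩ (fun x => Function.update x i 0) ⁻¹' {y}).ncard =
      (S ∩ (fun x => Function.update x i 0) ⁻¹' {y}).ncard := by
  by_cases hy : y i = 0
  · rw [ncard_inter_line y hy, ncard_inter_line y hy, lineFiber_lineCompression,
      Set.ncard_coe_finset, card_centeredInterval]
  · rw [inter_line_eq_empty y hy, inter_line_eq_empty y hy]

theorem ncard_lineCompression (hS : S.Finite) : (lineCompression i S).ncard = S.ncard :=
  le_antisymm
    (Set.ncard_le_ncard_of_fiberwise _ (lineCompression_finite hS) hS fun y =>
      (ncard_inter_line_lineCompression y).le)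
    (Set.ncard_le_ncard_of_fiberwise _ hS (lineCompression_finite hS) fun y =>
      (ncard_inter_line_lineCompression y).ge)

/-- The pairs counted by `edgeBoundaryCard`. -/
def edgeBoundary (S : Set (Fin n → ℤ)) : Set ((Fin n → ℤ) × (Fin n → ℤ)) :=
  {p | p.1 ∈ S ∧ p.2 ∉ S ∧ p.1 ≠ p.2 ∧ ∀ j, |p.1 j - p.2 j| ≤ 1}

theorem edgeBoundary_finite (hS : S.Finite) : (edgeBoundary S).Finite := by
  refine (hS.biUnion fun u _ => (Set.finite_Icc (u - 1) (u + 1)).image (Prod.mk u)).subset ?_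
  rintro ⟨u, v⟩ ⟨hu, -, -, h⟩
  simp only [Set.mem_iUnion, Set.mem_image, exists_prop]
  refine ⟨u, hu, v, ⟨fun j => ?_, fun j => ?_⟩, rfl⟩
  all_goals
    have := abs_le.1 (h j)
    simp only [Pi.sub_apply, Pi.add_apply, Pi.one_apply]
    dsimp only at this
    omega

/-- The projection of a pair of points along direction `i`. -/
def lineProj (i : Fin n) (p : (Fin n → ℤ) × (Fin n → ℤ)) : (Fin n → ℤ) × (Fin n → ℤ) :=
  (Function.update p.1 i 0, Function.update p.2 i 0)

theorem ncard_edgeBoundary_inter_fiber {y z : Fin n → ℤ} (hy : y i = 0) (hz : z i = 0)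
    (hyz : ∀ j, |y j - z j| ≤ 1) {A B : Finset ℤ} (hA : lineFiber i S y = A)
    (hB : lineFiber i S z = B) :
    (edgeBoundary S ∩ lineProj i ⁻¹' {(y, z)}).ncard = #(exitPairs A B) := by
  rw [← Set.ncard_coe_finset]
  refine Set.ncard_congr (fun p _ => (p.1 i, p.2 i)) ?_ ?_ ?_
  · rintro ⟨u, v⟩ ⟨⟨hu, hv, -, h⟩, huv⟩
    obtain ⟨h1, h2⟩ := Prod.mk.inj huv
    rw [mem_coe, mem_exitPairs, ← mem_coe, ← mem_coe, ← hA, ← hB, mem_lineFiber_self h1,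
      mem_lineFiber_self h2]
    exact ⟨hu, hv, h i⟩
  · rintro ⟨u, v⟩ ⟨u', v'⟩ ⟨_, h⟩ ⟨_, h'⟩ he
    obtain ⟨h1, h2⟩ := Prod.mk.inj h
    obtain ⟨h1', h2'⟩ := Prod.mk.inj h'
    obtain ⟨e1, e2⟩ := Prod.mk.inj he
    dsimp only at h1 h2 h1' h2' e1 e2
    refine Prod.ext (funext fun j => ?_) (funext fun j => ?_) <;> rcases eq_or_ne j i with rfl | hj
    · exact e1
    · simpa [hj] using congrFun (h1.trans h1'.symm) j
    · exact e2
    · simpa [hj] using congrFun (h2.trans h2'.symm) j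
  · rintro ⟨a, b⟩ hab
    rw [mem_coe, mem_exitPairs, ← mem_coe, ← mem_coe, ← hA, ← hB] at hab
    obtain ⟨ha, hb, hd⟩ := hab
    refine ⟨(Function.update y i a, Function.update z i b), ⟨⟨ha, hb, ?_, fun j => ?_⟩, ?_⟩,
      by simp⟩
    · intro h
      dsimp only at h
      have ha : Function.update y i a ∈ S := ha
      rw [h] at ha
      exact hb ha
    · rcases eq_or_ne j i with rfl | hj
      · simpa using hd
      · simpa [hj] using hyz j
    · exact Prod.ext (by simp [lineProj, ← hy]) (by simp [lineProj, ← hz])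

theorem edgeBoundary_inter_fiber_eq_empty {y z : Fin n → ℤ}
    (h : ¬(y i = 0 ∧ z i = 0 ∧ ∀ j, |y j - z j| ≤ 1)) :
    edgeBoundary S ∩ lineProj i ⁻¹' {(y, z)} = ∅ := by
  rw [Set.eq_empty_iff_forall_notMem]
  rintro ⟨u, v⟩ ⟨⟨-, -, -, hd⟩, huv⟩
  obtain ⟨rfl, rfl⟩ := Prod.mk.inj huv
  refine h ⟨by simp, by simp, fun j => ?_⟩
  rcases eq_or_ne j i with rfl | hj
  · simp
  · simpa [hj] using hd j

theorem ncard_edgeBoundary_lineCompression_le (hS : S.Finite) :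
    (edgeBoundary (lineCompression i S)).ncard ≤ (edgeBoundary S).ncard := by
  refine Set.ncard_le_ncard_of_fiberwise (lineProj i)
    (edgeBoundary_finite (lineCompression_finite hS)) (edgeBoundary_finite hS) ?_
  rintro ⟨y, z⟩
  by_cases h : y i = 0 ∧ z i = 0 ∧ ∀ j, |y j - z j| ≤ 1
  · obtain ⟨hy, hz, hyz⟩ := h
    rw [ncard_edgeBoundary_inter_fiber hy hz hyz (lineFiber_lineCompression y)
        (lineFiber_lineCompression z),
      ncard_edgeBoundary_inter_fiber hy hz hyz (lineFiber_finite hS y).coe_toFinset.symm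
        (lineFiber_finite hS z).coe_toFinset.symm,
      Set.ncard_eq_toFinset_card _ (lineFiber_finite hS y),
      Set.ncard_eq_toFinset_card _ (lineFiber_finite hS z)]
    exact card_exitPairs_centeredInterval_card_le _ _
  · rw [edgeBoundary_inter_fiber_eq_empty h, edgeBoundary_inter_fiber_eq_empty h]

theorem mem_lineCompression_add_smul_single (x : Fin n → ℤ) (t : ℤ) :
    x + t • Pi.single i 1 ∈ lineCompression i S ↔
      x i + t ∈ centeredInterval (lineFiber i S x).ncard := by
  have h : x + t • Pi.single i 1 = Function.update x i (x i + t) := by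
    ext j
    rcases eq_or_ne j i with rfl | hj
    · simp
    · simp [hj]
  rw [h, ← mem_coe, ← lineFiber_lineCompression]
  rfl

theorem gapSet_lineCompression_smul_single (s : ℤ) (hs : s = 1 ∨ s = -1) :
    gapSet n (lineCompression i S) (s • Pi.single i 1) = ∅ := by
  rw [Set.eq_empty_iff_forall_notMem]
  rintro x ⟨h1, h2, b, hb, h3⟩
  have e : x = x + (0 : ℤ) • Pi.single i 1 := by simp
  rw [sub_eq_add_neg, ← neg_smul, mem_lineCompression_add_smul_single] at h1
  rw [e, mem_lineCompression_add_smul_single] at h2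
  rw [smul_smul, mem_lineCompression_add_smul_single] at h3
  rw [mem_centeredInterval] at h1 h2 h3
  rcases hs with rfl | rfl <;> omega

end LineFiber

end

theorem exists_same_card_le_boundary_no_gap_in_basis_direction
    (n : ℕ) (hn : 1 ≤ n) (S : Set (Fin n → ℤ)) (hS : S.Finite) (i : Fin n) :
    ∃ S' : Set (Fin n → ℤ), S'.Finite ∧ Set.ncard S' = Set.ncard S ∧
      edgeBoundaryCard n S' ≤ edgeBoundaryCard n S ∧
      gapSet n S' (Pi.single i 1) = ∅ ∧ gapSet n S' (-Pi.single i 1) = ∅ := by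
  refine ⟨lineCompression i S, lineCompression_finite hS, ncard_lineCompression hS,
    ncard_edgeBoundary_lineCompression_le hS, ?_, ?_⟩
  · simpa using gapSet_lineCompression_smul_single (S := S) (i := i) 1 (Or.inl rfl)
  · simpa using gapSet_lineCompression_smul_single (S := S) (i := i) (-1) (Or.inr rfl)
end

section
/- Let n ≥ 1, let S ⊆ ℤⁿ be a finite set, let u ∈ S, and let ε ∈ {-1,0,1}ⁿ with ε ≠ 0. If both u + ε ∈ S and u - ε ∈ S, then gap_ε(S) = gap_ε(S \ {u}) \ {u}. -/
theorem gap_remove_interior_point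
    (n : ℕ) (hn : 1 ≤ n) (S : Set (Fin n → ℤ)) (hS : S.Finite)
    (u : Fin n → ℤ) (hu : u ∈ S)
    (ε : Fin n → ℤ) (hε : ∀ i, ε i = -1 ∨ ε i = 0 ∨ ε i = 1) (hε0 : ε ≠ 0)
    (hp : u + ε ∈ S) (hm : u - ε ∈ S) :
    gapSet n S ε = gapSet n (S \ {u}) ε \ {u} := by
  ext x
  constructor
  · rintro ⟨hxm, hx, b, hb, hxb⟩
    have hxu : x ≠ u := fun h => hx (h ▸ hu)
    refine ⟨⟨⟨hxm, fun h => hx ?_⟩, fun h => hx h.1, ?_⟩, hxu⟩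
    · rwa [sub_eq_iff_eq_add.mp h]
    · by_cases h : x + b • ε = u
      · have hnext : x + (b + 1) • ε = u + ε := by
          rw [add_smul, one_smul, ← add_assoc, h]
        refine ⟨b + 1, by lia, ?_⟩
        rw [hnext]
        exact ⟨hp, fun h' => hε0 (add_eq_left.mp h')⟩
      · exact ⟨b, hb, hxb, h⟩
  · rintro ⟨⟨hxm, hx, b, hb, hxb⟩, hxu⟩
    exact ⟨hxm.1, fun h => hx ⟨h, hxu⟩, b, hb, hxb.1⟩
end
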